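/- Let A be a (possibly noncommutative) ring, S a Finset of an index type, and e : ι → A a family such that for all α, β ∈ S, e α * e α = e α and e α * e β = e β * e α. Then for every natural number k ≥ 1, (∑_{α∈S} e α)^k = ∑_{l=1}^{S.card} S(k,l) · l! · ∑_{T ⊆ S, T.card = l} ∏_{α∈T} e α, where S(k,l) is the Stirling number of the second kind and the inner products are well defined since the e α pairwise commute. -/

import Mathlib

/-- The Stirling number of the second kind `S(k,l)`: the number of partitions
of a `k`-element set into exactly `l` nonempty blocks, realized as the number
of finpartitions of `Finset.univ : Finset (Fin k)` with exactly `l` parts. -/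
noncomputable def stirlingSecond (k l : ℕ) : ℕ :=
  Nat.card {P : Finpartition (Finset.univ : Finset (Fin k)) // P.parts.card = l}

theorem card_fun_image_eq {ι : Type*} [DecidableEq ι] (k : ℕ) (T : Finset ι) :
    Nat.card {f : Fin k → ι // Finset.univ.image f = T} =
      stirlingSecond k T.card * Nat.factorial T.card := by
  classical
  let X := Σ P : {P : Finpartition (Finset.univ : Finset (Fin k)) // P.parts.card = T.card},
    (P.1.parts ≃ T)
  have hX : Nat.card X = stirlingSecond k T.card * Nat.factorial T.card := by
    rw [Nat.card_sigma]
    have : ∀ P : {P : Finpartition (Finset.univ : Finset (Fin k)) // P.parts.card = T.card},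
        Nat.card (P.1.parts ≃ T) = Nat.factorial T.card := by
      intro P
      have e : P.1.parts ≃ T := Fintype.equivOfCardEq (by simpa using P.2)
      rw [Nat.card_eq_fintype_card, Fintype.card_equiv e]
      simp [P.2]
    simp only [this]
    simp [stirlingSecond, Nat.card_eq_fintype_card]
  rw [← hX]
  let g : X → (Fin k → ι) := fun x i =>
    (x.2 ⟨x.1.1.part i, x.1.1.part_mem.2 (Finset.mem_univ i)⟩ : T)
  have hpart : ∀ (P : Finpartition (Finset.univ : Finset (Fin k))) (p) (hp : p ∈ P.parts),
      ∃ i, P.part i = p := by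
    intro P p hp
    obtain ⟨i, hi⟩ := P.nonempty_of_mem_parts hp
    exact ⟨i, P.part_eq_of_mem hp hi⟩
  have hg : ∀ x, Finset.univ.image (g x) = T := by
    intro x
    ext t
    simp only [Finset.mem_image, Finset.mem_univ, true_and]
    constructor
    · rintro ⟨i, rfl⟩
      exact Subtype.property _
    · intro ht
      obtain ⟨i, hi⟩ := hpart x.1.1 _ (x.2.symm ⟨t, ht⟩).2
      refine ⟨i, ?_⟩
      simp [g, hi]
  have hrel : ∀ x i j, g x i = g x j ↔ i ∈ x.1.1.part j := by
    intro x i j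
    simp only [g]
    rw [Subtype.coe_injective.eq_iff, x.2.injective.eq_iff, Subtype.mk.injEq,
      x.1.1.mem_part_iff_part_eq_part (Finset.mem_univ _) (Finset.mem_univ _)]
  symm
  refine Nat.card_congr (Equiv.ofBijective (fun x => ⟨g x, hg x⟩) ⟨?_, ?_⟩)
  · intro x y hxy
    have hxy : g x = g y := congrArg Subtype.val hxy
    have hp : ∀ j, x.1.1.part j = y.1.1.part j := by
      intro j
      ext i
      rw [← hrel, ← hrel, hxy]
    have hPQ : x.1 = y.1 := by
      apply Subtype.ext
      apply Finpartition.ext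
      ext p
      constructor
      · intro h
        obtain ⟨i, rfl⟩ := hpart _ _ h
        rw [hp]; exact y.1.1.part_mem.2 (Finset.mem_univ i)
      · intro h
        obtain ⟨i, rfl⟩ := hpart _ _ h
        rw [← hp]; exact x.1.1.part_mem.2 (Finset.mem_univ i)
    obtain ⟨P, σ⟩ := x
    obtain ⟨Q, τ⟩ := y
    dsimp only at hPQ
    subst hPQ
    congr 1
    ext ⟨p, h⟩
    obtain ⟨i, rfl⟩ := hpart _ _ h
    exact congrFun hxy i
  · rintro ⟨f, hf⟩
    let F : ι → Finset (Fin k) := fun t => Finset.univ.filter (f · = t)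
    have hfT : ∀ i, f i ∈ T := fun i => hf ▸ Finset.mem_image_of_mem f (Finset.mem_univ i)
    have hFinj : Set.InjOn F T := by
      intro t ht s hs hts
      rw [Finset.mem_coe, ← hf] at ht
      obtain ⟨i, -, rfl⟩ := Finset.mem_image.1 ht
      have : i ∈ F (f i) := by simp [F]
      rw [hts] at this
      simpa [F] using this
    let P : Finpartition (Finset.univ : Finset (Fin k)) :=
      Finpartition.ofExistsUnique (T.image F) (fun _ _ => Finset.subset_univ _)
        (by
          intro i _
          refine ⟨F (f i), ⟨Finset.mem_image_of_mem _ (hfT i), by simp [F]⟩, ?_⟩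
          rintro p ⟨hp, hi⟩
          obtain ⟨t, ht, rfl⟩ := Finset.mem_image.1 hp
          have : f i = t := by simpa [F] using hi
          rw [this])
        (by
          intro h
          obtain ⟨t, ht, h0⟩ := Finset.mem_image.1 h
          rw [← hf] at ht
          obtain ⟨i, -, rfl⟩ := Finset.mem_image.1 ht
          have : i ∈ F (f i) := by simp [F]
          rw [h0] at this
          simp at this)
    have hPp : P.parts = T.image F := rfl
    have hPc : P.parts.card = T.card := by rw [hPp, Finset.card_image_of_injOn hFinj]
    let σ : T ≃ P.parts := Equiv.ofBijective
      (fun t => ⟨F t, Finset.mem_image_of_mem _ t.2⟩)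
      ⟨fun s t h => Subtype.ext (hFinj s.2 t.2 (congrArg Subtype.val h)), by
        rintro ⟨p, hp⟩
        obtain ⟨t, ht, rfl⟩ := Finset.mem_image.1 hp
        exact ⟨⟨t, ht⟩, rfl⟩⟩
    refine ⟨⟨⟨P, hPc⟩, σ.symm⟩, ?_⟩
    apply Subtype.ext
    funext i
    have h1 : (⟨P.part i, P.part_mem.2 (Finset.mem_univ i)⟩ : P.parts) = σ ⟨f i, hfT i⟩ := by
      apply Subtype.ext
      apply P.part_eq_of_mem (Finset.mem_image_of_mem _ (hfT i))
      simp [F]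
    simp only [g]
    rw [h1, Equiv.symm_apply_apply]

theorem sum_idempotents_pow_comm {A : Type*} [CommRing A] {ι : Type*} [DecidableEq ι]
    (S : Finset ι) (e : ι → A) (hidem : ∀ α ∈ S, e α * e α = e α) (k : ℕ) (hk : 1 ≤ k) :
    (∑ α ∈ S, e α) ^ k =
      ∑ l ∈ Finset.Icc 1 S.card, (stirlingSecond k l * Nat.factorial l) •
          ∑ T ∈ S.powerset.filter fun T => T.card = l, ∏ α ∈ T, e α := by
  classical
  have h1 : (∑ α ∈ S, e α) ^ k =
      ∑ f ∈ Fintype.piFinset (fun _ : Fin k => S), ∏ i, e (f i) := by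
    rw [← Finset.prod_univ_sum]; simp
  have hprod : ∀ f ∈ Fintype.piFinset (fun _ : Fin k => S),
      ∏ i, e (f i) = ∏ α ∈ Finset.univ.image f, e α := by
    intro f hf
    rw [Fintype.mem_piFinset] at hf
    rw [Finset.prod_comp e f]
    apply Finset.prod_congr rfl
    intro a ha
    obtain ⟨i, -, rfl⟩ := Finset.mem_image.1 ha
    apply IsIdempotentElem.pow_eq (hidem _ (hf i))
    rw [Finset.card_ne_zero]
    exact ⟨i, by simp⟩
  have h2 : (∑ α ∈ S, e α) ^ k = ∑ T ∈ S.powerset,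
      (stirlingSecond k T.card * Nat.factorial T.card) • ∏ α ∈ T, e α := by
    rw [h1, Finset.sum_congr rfl hprod]
    rw [← Finset.sum_fiberwise_of_maps_to (t := S.powerset) (g := fun f => Finset.univ.image f)]
    · apply Finset.sum_congr rfl
      intro T hT
      rw [Finset.sum_congr rfl (g := fun _ => ∏ α ∈ T, e α), Finset.sum_const]
      · congr 1
        rw [← card_fun_image_eq, Nat.subtype_card]
        intro f
        rw [Finset.mem_filter, Fintype.mem_piFinset]
        refine ⟨fun h => h.2, fun h => ⟨fun i => ?_, h⟩⟩
        exact Finset.mem_powerset.1 hT (h ▸ Finset.mem_image_of_mem f (Finset.mem_univ i))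
      · intro f hf
        rw [(Finset.mem_filter.1 hf).2]
    · intro f hf
      rw [Fintype.mem_piFinset] at hf
      rw [Finset.mem_powerset]
      intro a ha
      obtain ⟨i, -, rfl⟩ := Finset.mem_image.1 ha
      exact hf i
  have h0 : stirlingSecond k 0 * Nat.factorial 0 = 0 := by
    have := card_fun_image_eq k (∅ : Finset ℕ)
    rw [Finset.card_empty] at this
    rw [← this]
    have : IsEmpty {f : Fin k → ℕ // Finset.univ.image f = ∅} := ⟨fun f => by
      have := f.2 ▸ Finset.mem_image_of_mem f.1 (Finset.mem_univ (⟨0, hk⟩ : Fin k))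
      simp at this⟩
    exact Nat.card_of_isEmpty
  rw [h2, ← Finset.sum_fiberwise_of_maps_to (t := Finset.range (S.card + 1))
    (g := fun T => T.card)
    (fun T hT => Finset.mem_range.2 (Nat.lt_succ_of_le
      (Finset.card_le_card (Finset.mem_powerset.1 hT))))]
  symm
  rw [Finset.sum_subset (s₂ := Finset.range (S.card + 1))]
  · apply Finset.sum_congr rfl
    intro l hl
    rw [Finset.smul_sum]
    apply Finset.sum_congr rfl
    intro T hT
    rw [(Finset.mem_filter.1 hT).2]
  · intro l hl
    simp at hl ⊢; omega
  · intro l hl hl'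
    have : l = 0 := by simp at hl hl'; omega
    subst this
    rw [h0, zero_smul]

theorem map_prod_eq_noncommProd {R A ι : Type*} [CommRing R] [Ring A] (φ : R →+* A)
    (T : Finset ι) (e' : ι → R) (e : ι → A) (he : ∀ a ∈ T, φ (e' a) = e a)
    (hc : (T : Set ι).Pairwise (Function.onFun Commute e)) :
    φ (∏ a ∈ T, e' a) = T.noncommProd e hc := by
  rw [← Finset.noncommProd_eq_prod T e']
  refine (Finset.map_noncommProd T e' _ φ).trans ?_
  exact Finset.noncommProd_congr rfl he _

/-- for a pairwise-commuting family of idempotents `e α`, `α ∈ S`,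
in a (possibly noncommutative) ring, and every `k ≥ 1`,
`(∑_{α∈S} e α)^k = ∑_{l=1}^{|S|} S(k,l)·l! · ∑_{T⊆S, |T|=l} ∏_{α∈T} e α`. -/
theorem sum_idempotents_pow {A : Type*} [Ring A] {ι : Type*} [DecidableEq ι]
    (S : Finset ι) (e : ι → A)
    (hidem : ∀ α ∈ S, e α * e α = e α)
    (hcomm : ∀ α ∈ S, ∀ β ∈ S, e α * e β = e β * e α)
    (k : ℕ) (hk : 1 ≤ k) :
    (∑ α ∈ S, e α) ^ k =
      ∑ l ∈ Finset.Icc 1 S.card,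
        (stirlingSecond k l * Nat.factorial l) •
          ∑ T ∈ (S.powerset.filter fun T => T.card = l).attach,
            T.1.noncommProd e (fun x hx y hy _ =>
              hcomm x (Finset.mem_powerset.mp (Finset.mem_filter.mp T.2).1
                        (Finset.mem_coe.mp hx))
                    y (Finset.mem_powerset.mp (Finset.mem_filter.mp T.2).1
                        (Finset.mem_coe.mp hy))) := by
  classical
  let R := Subring.closure (e '' S)
  let : CommRing R := Subring.closureCommRingOfComm (by
    rintro _ ⟨a, ha, rfl⟩ _ ⟨b, hb, rfl⟩
    exact hcomm a ha b hb)
  let e' : ι → R := fun a => if h : a ∈ S then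
    ⟨e a, Subring.subset_closure (Set.mem_image_of_mem e h)⟩ else 0
  let φ : R →+* A := R.subtype
  have he : ∀ a ∈ S, φ (e' a) = e a := by
    intro a ha
    simp [e', ha, φ]
  have hφ : Function.Injective φ := Subtype.coe_injective
  have hid : ∀ a ∈ S, e' a * e' a = e' a := by
    intro a ha
    apply hφ
    rw [map_mul, he a ha, hidem a ha]
  have key := congrArg φ (sum_idempotents_pow_comm S e' hid k hk)
  rw [map_pow, map_sum, Finset.sum_congr rfl he] at key
  rw [key, map_sum]
  apply Finset.sum_congr rfl
  intro l hl
  rw [map_nsmul, map_sum, ← Finset.sum_attach]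
  congr 1
  apply Finset.sum_congr rfl
  intro T _
  have hTS : T.1 ⊆ S := Finset.mem_powerset.mp (Finset.mem_filter.mp T.2).1
  exact map_prod_eq_noncommProd φ T.1 e' e (fun a ha => he a (hTS ha)) _
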